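/- For each n ≥ 1 let t_n denote the number of pairs (T, J) where T is a labelled tree on Fin n (a connected acyclic simple graph) and J is a maximal independent set of T. Then there exist real constants c > 0 and ρ₁ with 0 < ρ₁ < e^{-1} such that the sequence t_n · ρ₁^n · n^{5/2} / n! converges to c as n → ∞. -/

import Mathlib

open Filter Topology

/-- `J` is an independent set of the simple graph `G`. -/
def IsIndepSet {V : Type*} (G : SimpleGraph V) (J : Set V) : Prop :=
  ∀ ⦃u v : V⦄, u ∈ J → v ∈ J → ¬ G.Adj u v

/-- `J` is a maximal independent set of `G`. -/
def IsMaximalIndepSet {V : Type*} (G : SimpleGraph V) (J : Set V) : Prop :=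
  IsIndepSet G J ∧ ∀ J' : Set V, IsIndepSet G J' → ¬ J ⊂ J'

/-- `tN n` is the number of pairs `(T, J)` where `T` is a labelled tree
(connected acyclic simple graph) on `Fin n` and `J` is a maximal independent
set of `T`. -/
noncomputable def tN (n : ℕ) : ℕ :=
  Nat.card {p : SimpleGraph (Fin n) × Set (Fin n) //
    p.1.IsTree ∧ IsMaximalIndepSet p.1 p.2}

section RootedForests

variable {V : Type*} [DecidableEq V]

/-- The colour `0` marks the vertices of the independent set, `1` the other vertices having a child
in the set, `2` those having none. `ColourAllowed a b` says that a child coloured `b` may hang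
from a parent coloured `a`. -/
def ColourAllowed (a b : Fin 3) : Prop :=
  (a = 0 ∧ b ≠ 0) ∨ (a = 1 ∧ b ≠ 2) ∨ (a = 2 ∧ b = 1)

/-- `x = (p, c)` is a coloured forest on `R ∪ U` with set of roots `R`: `p` maps each vertex of `U`
to its parent, `c` is the colouring, prescribed by `c₀` outside of `U`. -/
structure IsColouredForest (R U : Finset V) (c₀ : V → Fin 3) (x : (V → V) × (V → Fin 3)) :
    Prop where
  fix : ∀ v, v ∉ U → x.1 v = v
  col : ∀ v, v ∉ U → x.2 v = c₀ v
  mem : ∀ v ∈ U, x.1 v ∈ U ∨ x.1 v ∈ R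
  acyclic : ∀ S ⊆ U, (∀ v ∈ S, x.1 v ∈ S) → S = ∅
  allowed : ∀ v ∈ U, ColourAllowed (x.2 (x.1 v)) (x.2 v)
  dominated : ∀ v, v ∈ U ∨ v ∈ R → x.2 v = 1 → ∃ w ∈ U, x.1 w = v ∧ x.2 w = 0

open Classical in
/-- The finset of coloured forests. -/
noncomputable def colouredForests [Fintype V] (R U : Finset V) (c₀ : V → Fin 3) :
    Finset ((V → V) × (V → Fin 3)) :=
  Finset.univ.filter (IsColouredForest R U c₀)

lemma mem_colouredForests [Fintype V] {R U : Finset V} {c₀ : V → Fin 3}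
    {x : (V → V) × (V → Fin 3)} :
    x ∈ colouredForests R U c₀ ↔ IsColouredForest R U c₀ x := by
  simp [colouredForests]

/-- The condition on the sets of children of colours `0` and `2` of a root coloured `a`. -/
def ChildrenAllowed (a : Fin 3) (A C : Finset V) : Prop :=
  (a = 0 ∧ A = ∅) ∨ (a = 1 ∧ A ≠ ∅ ∧ C = ∅) ∨ (a = 2 ∧ A = ∅ ∧ C = ∅)

/-- The recolouring giving colours `0`, `1`, `2` to `A`, `B`, `C`. -/
def recolour (c₀ : V → Fin 3) (A B C : Finset V) (v : V) : Fin 3 :=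
  if v ∈ A then 0 else if v ∈ B then 1 else if v ∈ C then 2 else c₀ v

/-- The children of `r` having colour `a`. -/
def childrenOfColour (U : Finset V) (r : V) (a : Fin 3) (x : (V → V) × (V → Fin 3)) : Finset V :=
  U.filter fun v => x.1 v = r ∧ x.2 v = a

lemma IsColouredForest.childrenAllowed {R U A C : Finset V} {c₀ : V → Fin 3} {r : V}
    {x : (V → V) × (V → Fin 3)} (hd : Disjoint R U) (hr : r ∈ R) (hx : IsColouredForest R U c₀ x)
    (hA : childrenOfColour U r 0 x = A) (hC : childrenOfColour U r 2 x = C) :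
    ChildrenAllowed (c₀ r) A C := by
  have hrU : r ∉ U := Finset.disjoint_left.1 hd hr
  have hcr := hx.col r hrU
  have h3 : c₀ r = 0 ∨ c₀ r = 1 ∨ c₀ r = 2 := by generalize c₀ r = a; revert a; decide
  have hal : ∀ v ∈ U, x.1 v = r → ColourAllowed (c₀ r) (x.2 v) := by
    intro v hv h
    have := hx.allowed v hv
    rwa [h, hcr] at this
  have hdom := hx.dominated r (Or.inr hr)
  subst hA hC
  simp only [ChildrenAllowed, ColourAllowed, childrenOfColour, Finset.filter_eq_empty_iff,
    ne_eq] at *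
  rcases h3 with h | h | h
  · left
    refine ⟨h, fun v hv hh => ?_⟩
    have := hal v hv hh.1
    simp [h, hh.2] at this
  · right; left
    refine ⟨h, fun hh => ?_, fun v hv hh => ?_⟩
    · obtain ⟨w, hw, h1, h2⟩ := hdom (by rw [hcr, h])
      exact hh hw ⟨h1, h2⟩
    · have := hal v hv hh.1
      simp [h, hh.2] at this
  · right; right
    refine ⟨h, fun v hv hh => ?_, fun v hv hh => ?_⟩ <;>
    · have := hal v hv hh.1
      simp [h, hh.2] at this

/-- Removing a root, its children becoming roots. -/
lemma IsColouredForest.removeRoot {R U A B C : Finset V} {c₀ : V → Fin 3} {r : V}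
    {x : (V → V) × (V → Fin 3)} (hd : Disjoint R U) (hr : r ∈ R) (hx : IsColouredForest R U c₀ x)
    (hA : childrenOfColour U r 0 x = A) (hB : childrenOfColour U r 1 x = B)
    (hC : childrenOfColour U r 2 x = C) :
    IsColouredForest (R.erase r ∪ (A ∪ B ∪ C)) (((U \ A) \ B) \ C) (recolour c₀ A B C)
      (fun v => if v ∈ A ∪ B ∪ C then v else x.1 v, x.2) := by
  have hrU : r ∉ U := Finset.disjoint_left.1 hd hr
  have mA : ∀ v, v ∈ A ↔ v ∈ U ∧ x.1 v = r ∧ x.2 v = 0 := by subst hA; simp [childrenOfColour]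
  have mB : ∀ v, v ∈ B ↔ v ∈ U ∧ x.1 v = r ∧ x.2 v = 1 := by subst hB; simp [childrenOfColour]
  have mC : ∀ v, v ∈ C ↔ v ∈ U ∧ x.1 v = r ∧ x.2 v = 2 := by subst hC; simp [childrenOfColour]
  clear hA hB hC
  have h3 : ∀ v, x.2 v = 0 ∨ x.2 v = 1 ∨ x.2 v = 2 := by
    intro v; generalize x.2 v = a; revert a; decide
  have mS : ∀ v, v ∈ A ∪ B ∪ C ↔ v ∈ U ∧ x.1 v = r := by
    intro v
    simp only [Finset.mem_union, mA, mB, mC]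
    have := h3 v
    tauto
  have mU : ∀ v, v ∈ ((U \ A) \ B) \ C ↔ v ∈ U ∧ x.1 v ≠ r := by
    intro v
    have := mS v
    simp only [Finset.mem_union] at this
    simp only [Finset.mem_sdiff]
    tauto
  have mR : ∀ v, v ∈ R.erase r ∪ (A ∪ B ∪ C) ↔ (v ≠ r ∧ v ∈ R) ∨ (v ∈ U ∧ x.1 v = r) := by
    intro v
    rw [Finset.mem_union, mS, Finset.mem_erase]
  refine ⟨fun v hv => ?_, fun v hv => ?_, fun v hv => ?_, fun S hS h => ?_, fun v hv => ?_,
    fun v hv h => ?_⟩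
  · rw [mU] at hv
    simp only [mS]
    split_ifs with h
    · rfl
    · exact hx.fix v (by tauto)
  · rw [mU] at hv
    have hc := hx.col v
    simp only [recolour]
    split_ifs with h1 h2 h3'
    · exact ((mA v).1 h1).2.2
    · exact ((mB v).1 h2).2.2
    · exact ((mC v).1 h3').2.2
    · have := mS v
      simp only [Finset.mem_union] at this
      exact hc (by tauto)
  · rw [mU] at hv
    simp only [mS, mU, mR]
    rw [if_neg (by tauto)]
    have := hx.mem v hv.1
    tauto
  · have hSU : ∀ v ∈ S, v ∈ U ∧ x.1 v ≠ r := fun v hv => (mU v).1 (hS hv)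
    refine hx.acyclic S (fun v hv => (hSU v hv).1) fun v hv => ?_
    have := h v hv
    simp only [mS] at this
    rwa [if_neg (by have := hSU v hv; tauto)] at this
  · rw [mU] at hv
    simp only [mS]
    rw [if_neg (by tauto)]
    exact hx.allowed v hv.1
  · have hv' : (v ∈ U ∨ v ∈ R) ∧ v ≠ r := by
      rw [mU, mR] at hv
      have : v ∈ U → v ≠ r := fun h1 h2 => hrU (h2 ▸ h1)
      tauto
    obtain ⟨w, hw, h1, h2⟩ := hx.dominated v hv'.1 h
    have hne : x.1 w ≠ r := h1 ▸ hv'.2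
    refine ⟨w, (mU w).2 ⟨hw, hne⟩, ?_, h2⟩
    simp only [mS]
    rw [if_neg (by tauto), h1]

/-- Adding back a root. -/
lemma IsColouredForest.addRoot {R U A B C : Finset V} {c₀ : V → Fin 3} {r : V}
    {x : (V → V) × (V → Fin 3)} (hd : Disjoint R U) (hr : r ∈ R)
    (hAU : A ⊆ U) (hBU : B ⊆ U \ A) (hCU : C ⊆ (U \ A) \ B) (hok : ChildrenAllowed (c₀ r) A C)
    (hx : IsColouredForest (R.erase r ∪ (A ∪ B ∪ C)) (((U \ A) \ B) \ C) (recolour c₀ A B C) x) :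
    IsColouredForest R U c₀ (fun v => if v ∈ A ∪ B ∪ C then r else x.1 v, x.2) ∧
    childrenOfColour U r 0 (fun v => if v ∈ A ∪ B ∪ C then r else x.1 v, x.2) = A ∧
    childrenOfColour U r 1 (fun v => if v ∈ A ∪ B ∪ C then r else x.1 v, x.2) = B ∧
    childrenOfColour U r 2 (fun v => if v ∈ A ∪ B ∪ C then r else x.1 v, x.2) = C := by
  have hrU : r ∉ U := Finset.disjoint_left.1 hd hr
  have mS : ∀ v, v ∈ A ∪ B ∪ C ↔ v ∈ A ∨ v ∈ B ∨ v ∈ C := by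
    intro v; simp only [Finset.mem_union]; tauto
  have hBU' : ∀ v ∈ B, v ∈ U ∧ v ∉ A := fun v hv => by simpa using hBU hv
  have hCU' : ∀ v ∈ C, v ∈ U ∧ v ∉ A ∧ v ∉ B := fun v hv => by
    simpa [and_assoc] using hCU hv
  have mU : ∀ v, v ∈ ((U \ A) \ B) \ C ↔ v ∈ U ∧ ¬ (v ∈ A ∨ v ∈ B ∨ v ∈ C) := by
    intro v; simp only [Finset.mem_sdiff]; tauto
  have mR : ∀ v, v ∈ R.erase r ∪ (A ∪ B ∪ C) ↔ (v ≠ r ∧ v ∈ R) ∨ (v ∈ A ∨ v ∈ B ∨ v ∈ C) := by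
    intro v
    rw [Finset.mem_union, mS, Finset.mem_erase]
  have cA : ∀ v ∈ A, x.2 v = 0 := fun v hv => by
    rw [hx.col v (by rw [mU]; tauto)]; simp [recolour, hv]
  have cB : ∀ v ∈ B, x.2 v = 1 := fun v hv => by
    rw [hx.col v (by rw [mU]; tauto)]; simp [recolour, hv, hBU' v hv]
  have cC : ∀ v ∈ C, x.2 v = 2 := fun v hv => by
    rw [hx.col v (by rw [mU]; tauto)]; simp [recolour, hv, hCU' v hv]
  have hSU : ∀ v, v ∈ A ∨ v ∈ B ∨ v ∈ C → v ∈ U := by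
    rintro v (h | h | h)
    exacts [hAU h, (hBU' v h).1, (hCU' v h).1]
  have hne : ∀ v ∈ U, ¬ (v ∈ A ∨ v ∈ B ∨ v ∈ C) → x.1 v ≠ r := by
    intro v hv h1 h2
    have := hx.mem v ((mU v).2 ⟨hv, h1⟩)
    rw [h2, mU, mR] at this
    have := hSU r
    tauto
  have hcol : ∀ v, v ∉ U → x.2 v = c₀ v := by
    intro v hv
    have h1 : v ∉ A := fun h => hv (hSU v (Or.inl h))
    have h2 : v ∉ B := fun h => hv (hSU v (Or.inr (Or.inl h)))
    have h3 : v ∉ C := fun h => hv (hSU v (Or.inr (Or.inr h)))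
    rw [hx.col v (by rw [mU]; tauto)]; simp [recolour, h1, h2, h3]
  refine ⟨⟨fun v hv => ?_, hcol, fun v hv => ?_, fun S hS h => ?_, fun v hv => ?_,
    fun v hv h => ?_⟩, ?_, ?_, ?_⟩
  · simp only [mS]
    rw [if_neg (fun h => hv (hSU v h))]
    exact hx.fix v (by rw [mU]; tauto)
  · simp only [mS]
    split_ifs with h
    · exact Or.inr hr
    · have := hx.mem v ((mU v).2 ⟨hv, h⟩)
      have h2 := hSU (x.1 v)
      rw [mU, mR] at this
      tauto
  · have hS' : ∀ v ∈ S, ¬ (v ∈ A ∨ v ∈ B ∨ v ∈ C) := by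
      intro v hv h1
      have := h v hv
      simp only [mS] at this
      rw [if_pos h1] at this
      exact hrU (hS this)
    refine hx.acyclic S (fun v hv => (mU v).2 ⟨hS hv, hS' v hv⟩) fun v hv => ?_
    have := h v hv
    simp only [mS] at this
    rwa [if_neg (hS' v hv)] at this
  · simp only [mS]
    split_ifs with h
    · rw [hcol r hrU]
      simp only [ChildrenAllowed, ColourAllowed, Finset.eq_empty_iff_forall_notMem] at *
      rcases h with h | h | h
      · rw [cA v h]; grind
      · rw [cB v h]; grind
      · rw [cC v h]; grind
    · exact hx.allowed v ((mU v).2 ⟨hv, h⟩)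
  · simp only [mS]
    by_cases hvr : v = r
    · subst hvr
      simp only at h
      rw [hcol v hrU] at h
      rcases hok with h1 | h1 | h1
      · simp [h1.1] at h
      · obtain ⟨w, hw⟩ := Finset.nonempty_iff_ne_empty.2 h1.2.1
        exact ⟨w, hAU hw, by rw [if_pos (Or.inl hw)], cA w hw⟩
      · simp [h1.1] at h
    · obtain ⟨w, hw, h1, h2⟩ := hx.dominated v (by rw [mU, mR]; tauto) h
      rw [mU] at hw
      exact ⟨w, hw.1, by rw [if_neg hw.2, h1], h2⟩
  all_goals
    ext v
    simp only [childrenOfColour, Finset.mem_filter, mS]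
    have := hne v
    have := hSU v
    have := cA v
    have := cB v
    have := cC v
    grind

open Classical in
lemma card_filter_childrenOfColour [Fintype V] {R U A B C : Finset V} {c₀ : V → Fin 3} {r : V}
    (hd : Disjoint R U) (hr : r ∈ R) (hAU : A ⊆ U) (hBU : B ⊆ U \ A) (hCU : C ⊆ (U \ A) \ B) :
    ((((colouredForests R U c₀).filter (childrenOfColour U r 0 · = A)).filter
      (childrenOfColour U r 1 · = B)).filter (childrenOfColour U r 2 · = C)).card =
    if ChildrenAllowed (c₀ r) A C then
      (colouredForests (R.erase r ∪ (A ∪ B ∪ C)) (((U \ A) \ B) \ C) (recolour c₀ A B C)).card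
    else 0 := by
  split_ifs with hok
  · refine Finset.card_nbij'
      (fun x => (fun v => if v ∈ A ∪ B ∪ C then v else x.1 v, x.2))
      (fun x => (fun v => if v ∈ A ∪ B ∪ C then r else x.1 v, x.2)) ?_ ?_ ?_ ?_
    · intro x hx
      simp only [Finset.coe_filter, Finset.mem_filter, mem_colouredForests, Set.mem_ofPred_eq] at hx
      simp only [Finset.mem_coe, mem_colouredForests]
      exact hx.1.1.1.removeRoot hd hr hx.1.1.2 hx.1.2 hx.2
    · intro x hx
      simp only [Finset.mem_coe, mem_colouredForests] at hx
      have := hx.addRoot hd hr hAU hBU hCU hok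
      simp only [Finset.coe_filter, Finset.mem_filter, mem_colouredForests, Set.mem_ofPred_eq]
      tauto
    · intro x hx
      simp only [Finset.coe_filter, Finset.mem_filter, mem_colouredForests, Set.mem_ofPred_eq] at hx
      ext v : 2
      · simp only
        split_ifs with h
        · obtain ⟨⟨⟨-, rfl⟩, rfl⟩, rfl⟩ := hx
          simp only [childrenOfColour, Finset.mem_union, Finset.mem_filter] at h
          tauto
        · rfl
      · rfl
    · intro x hx
      simp only [Finset.mem_coe, mem_colouredForests] at hx
      ext v : 2
      · simp only
        split_ifs with h
        · refine (hx.fix v ?_).symm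
          simp only [Finset.mem_union] at h
          simp only [Finset.mem_sdiff]
          tauto
        · rfl
      · rfl
  · rw [Finset.card_eq_zero, Finset.eq_empty_iff_forall_notMem]
    intro x hx
    simp only [Finset.mem_filter, mem_colouredForests] at hx
    exact hok (hx.1.1.1.childrenAllowed hd hr hx.1.1.2 hx.2)

open Classical in
/-- Classifying the forests by the children of a root. -/
lemma card_colouredForests [Fintype V] {R U : Finset V} {c₀ : V → Fin 3} {r : V}
    (hd : Disjoint R U) (hr : r ∈ R) :
    (colouredForests R U c₀).card =
      ∑ A ∈ U.powerset, ∑ B ∈ (U \ A).powerset, ∑ C ∈ ((U \ A) \ B).powerset,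
        if ChildrenAllowed (c₀ r) A C then
          (colouredForests (R.erase r ∪ (A ∪ B ∪ C)) (((U \ A) \ B) \ C) (recolour c₀ A B C)).card
        else 0 := by
  rw [Finset.card_eq_sum_card_fiberwise (f := childrenOfColour U r 0) (t := U.powerset)
    (fun x _ => by
      simp only [Finset.coe_powerset, Set.mem_preimage, Set.mem_powerset_iff, Finset.coe_subset]
      exact Finset.filter_subset _ _)]
  refine Finset.sum_congr rfl fun A hA => ?_
  rw [Finset.card_eq_sum_card_fiberwise (f := childrenOfColour U r 1) (t := (U \ A).powerset)
    (fun x hx => by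
      simp only [Finset.coe_filter, Set.mem_ofPred_eq] at hx
      simp only [Finset.coe_powerset, Set.mem_preimage, Set.mem_powerset_iff, Finset.coe_subset]
      intro v hv
      obtain ⟨-, rfl⟩ := hx
      simp only [childrenOfColour, Finset.mem_filter, Finset.mem_sdiff] at hv ⊢
      grind)]
  refine Finset.sum_congr rfl fun B hB => ?_
  rw [Finset.card_eq_sum_card_fiberwise (f := childrenOfColour U r 2)
    (t := ((U \ A) \ B).powerset)
    (fun x hx => by
      simp only [Finset.coe_filter, Finset.mem_filter, Set.mem_ofPred_eq] at hx
      simp only [Finset.coe_powerset, Set.mem_preimage, Set.mem_powerset_iff, Finset.coe_subset]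
      intro v hv
      obtain ⟨⟨-, rfl⟩, rfl⟩ := hx
      simp only [childrenOfColour, Finset.mem_filter, Finset.mem_sdiff] at hv ⊢
      grind)]
  refine Finset.sum_congr rfl fun C hC => ?_
  rw [Finset.mem_powerset] at hA hB hC
  exact card_filter_childrenOfColour hd hr hA hB hC

end RootedForests

section ParentGraph

variable {V : Type*} [Fintype V] [DecidableEq V]

/-- The graph joining each vertex to its parent. -/
def parentGraph {V : Type*} (p : V → V) : SimpleGraph V :=
  SimpleGraph.fromRel fun u v => p u = v

lemma parentGraph_adj {V : Type*} {p : V → V} {u v : V} :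
    (parentGraph p).Adj u v ↔ u ≠ v ∧ (p u = v ∨ p v = u) := by
  simp [parentGraph]

lemma parent_induction {p : V → V} {r : V}
    (hp : ∀ S ⊆ Finset.univ.erase r, (∀ v ∈ S, p v ∈ S) → S = ∅) {Q : V → Prop} (h0 : Q r)
    (hs : ∀ v, v ≠ r → Q (p v) → Q v) (v : V) : Q v := by
  classical
  by_contra hv
  have := hp (Finset.univ.filter fun v => ¬ Q v)
    (fun v hv => by
      simp only [Finset.mem_filter, Finset.mem_univ, true_and, Finset.mem_erase, and_true] at hv ⊢
      rintro rfl
      exact hv h0)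
    (fun v hv => by
      simp only [Finset.mem_filter, Finset.mem_univ, true_and] at hv ⊢
      exact fun h => hv (hs v (fun h' => hv (h' ▸ h0)) h))
  rw [Finset.eq_empty_iff_forall_notMem] at this
  exact this v (by simpa using hv)

lemma parent_ne {p : V → V} {r : V}
    (hp : ∀ S ⊆ Finset.univ.erase r, (∀ v ∈ S, p v ∈ S) → S = ∅) {v : V} (hv : v ≠ r) :
    p v ≠ v := by
  intro h
  have := hp {v} (by simpa using hv) (by simp [h])
  simp at this

lemma parent_parent_ne {p : V → V} {r : V}
    (hp : ∀ S ⊆ Finset.univ.erase r, (∀ v ∈ S, p v ∈ S) → S = ∅) {v : V} (hv : v ≠ r)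
    (hv' : p v ≠ r) : p (p v) ≠ v := by
  intro h
  have := hp {v, p v} (by intro w; simp; rintro (rfl | rfl) <;> assumption)
    (by intro w; simp; rintro (rfl | rfl) <;> simp [h])
  simp at this

lemma isTree_parentGraph {p : V → V} {r : V}
    (hp : ∀ S ⊆ Finset.univ.erase r, (∀ v ∈ S, p v ∈ S) → S = ∅) (hr : p r = r) :
    (parentGraph p).IsTree := by
  have hconn : (parentGraph p).Connected := by
    have h : ∀ v, (parentGraph p).Reachable v r := by
      refine parent_induction hp (SimpleGraph.Reachable.refl _) fun v hv h => ?_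
      exact (SimpleGraph.Adj.reachable
        (parentGraph_adj.2 ⟨(parent_ne hp hv).symm, Or.inl rfl⟩)).trans h
    exact { preconnected := fun u v => (h u).trans (h v).symm, nonempty := ⟨r⟩ }
  rw [SimpleGraph.isTree_iff_connected_and_card]
  refine ⟨hconn, le_antisymm ?_ hconn.card_vert_le_card_edgeSet_add_one⟩
  have hsub : (parentGraph p).edgeSet ⊆
      ((Finset.univ.erase r).image fun v => s(v, p v) : Finset (Sym2 V)) := by
    intro e
    induction e using Sym2.ind with
    | _ u v =>
      rw [SimpleGraph.mem_edgeSet, parentGraph_adj]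
      simp only [Finset.coe_image, Set.mem_image, Finset.mem_coe, Finset.mem_erase,
        Finset.mem_univ, and_true]
      rintro ⟨hne, h | h⟩
      · exact ⟨u, fun h' => hne (by rw [← h, h', hr]), by rw [h]⟩
      · exact ⟨v, fun h' => hne (by rw [← h, h', hr]), by rw [h, Sym2.eq_swap]⟩
  have h1 := Nat.card_mono (Finset.finite_toSet _) hsub
  have h2 : Nat.card (((Finset.univ.erase r).image fun v => s(v, p v) : Finset (Sym2 V)) :
      Set (Sym2 V)) ≤ (Finset.univ.erase r).card := by
    rw [Nat.card_eq_fintype_card]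
    simpa only [Finset.coe_sort_coe, Fintype.card_coe] using Finset.card_image_le
  have h3 := Finset.card_erase_add_one (Finset.mem_univ r)
  rw [Finset.card_univ] at h3
  rw [Nat.card_eq_fintype_card (α := V)]
  omega

lemma parentGraph_injective {p q : V → V} {r : V} (hpr : p r = r)
    (hq : ∀ S ⊆ Finset.univ.erase r, (∀ v ∈ S, q v ∈ S) → S = ∅) (hqr : q r = r)
    (h : parentGraph p = parentGraph q) : p = q := by
  funext v
  refine parent_induction (Q := fun v => p v = q v) hq (by rw [hpr, hqr]) (fun v hv ih => ?_) v
  have hadj : (parentGraph p).Adj v (q v) := by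
    rw [h]
    exact parentGraph_adj.2 ⟨(parent_ne hq hv).symm, Or.inl rfl⟩
  obtain ⟨hne, h1 | h1⟩ := parentGraph_adj.1 hadj
  · exact h1
  · by_cases hqv : q v = r
    · rw [hqv, hpr] at h1
      exact absurd h1.symm hv
    · rw [ih] at h1
      exact absurd h1 (parent_parent_ne hq hv hqv)

lemma exists_parentGraph_eq {G : SimpleGraph V} (hG : G.IsTree) (r : V) :
    ∃ p : V → V, (∀ S ⊆ Finset.univ.erase r, (∀ v ∈ S, p v ∈ S) → S = ∅) ∧ p r = r ∧
      parentGraph p = G := by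
  have h1 : ∀ v, v ≠ r → ∃ w, G.Adj v w ∧ G.dist w r < G.dist v r := by
    intro v hv
    obtain ⟨W, hW⟩ := hG.connected.exists_walk_length_eq_dist v r
    cases W with
    | nil => exact absurd rfl hv
    | cons h W' =>
      refine ⟨_, h, ?_⟩
      have := SimpleGraph.dist_le W'
      rw [SimpleGraph.Walk.length_cons] at hW
      omega
  choose! p hp using h1
  have hq : ∀ v, v ≠ r → (if v = r then r else p v) = p v := fun v hv => if_neg hv
  have hac : ∀ S ⊆ Finset.univ.erase r, (∀ v ∈ S, (if v = r then r else p v) ∈ S) → S = ∅ := by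
    intro S hS h
    by_contra hne
    obtain ⟨v, hv, hmin⟩ := S.exists_min_image (fun v => G.dist v r)
      (Finset.nonempty_iff_ne_empty.2 hne)
    have hvr : v ≠ r := by simpa using hS hv
    have h2 := hmin _ (h v hv)
    rw [hq v hvr] at h2
    exact absurd (hp v hvr).2 (not_lt.2 h2)
  refine ⟨fun v => if v = r then r else p v, hac, if_pos rfl, ?_⟩
  have hT := isTree_parentGraph (p := fun v => if v = r then r else p v) hac (if_pos rfl)
  refine ((SimpleGraph.isTree_iff_minimal_connected.1 hG).eq_of_le hT.connected ?_)
  intro u v huv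
  have key : ∀ u v, u ≠ v → (if u = r then r else p u) = v → G.Adj u v := by
    intro u v hne h
    split_ifs at h with hu
    · exact absurd (hu.trans h) hne
    · exact h ▸ (hp u hu).1
  obtain ⟨hne, h | h⟩ := parentGraph_adj.1 huv
  · exact key u v hne h
  · exact (key v u hne.symm h).symm

lemma isMaximalIndepSet_iff {V : Type*} {G : SimpleGraph V} {J : Set V} :
    IsMaximalIndepSet G J ↔ IsIndepSet G J ∧ ∀ v, v ∉ J → ∃ w ∈ J, G.Adj v w := by
  refine and_congr_right fun hJ => ⟨fun h v hv => ?_, fun h J' hJ' hss => ?_⟩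
  · by_contra! hcon
    refine h (insert v J) ?_ (Set.ssubset_insert hv)
    rintro a b (rfl | ha) (rfl | hb) hab
    · exact G.loopless.irrefl _ hab
    · exact hcon b hb hab
    · exact hcon a ha hab.symm
    · exact hJ ha hb hab
  · obtain ⟨v, hv, hvJ⟩ := Set.exists_of_ssubset hss
    obtain ⟨w, hw, hvw⟩ := h v hvJ
    exact hJ' hv (hss.1 hw) hvw

lemma IsColouredForest.isMaximalIndepSet {r : V} {c₀ : V → Fin 3} {x : (V → V) × (V → Fin 3)}
    (hx : IsColouredForest {r} (Finset.univ.erase r) c₀ x) (hr : x.2 r ≠ 2) :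
    IsMaximalIndepSet (parentGraph x.1) {v | x.2 v = 0} := by
  have hxr : x.1 r = r := hx.fix r (by simp)
  have hal : ∀ v, v ≠ r → ColourAllowed (x.2 (x.1 v)) (x.2 v) := fun v hv =>
    hx.allowed v (by simpa using hv)
  rw [isMaximalIndepSet_iff]
  constructor
  · have key : ∀ u v, u ≠ v → x.1 u = v → x.2 u = 0 → x.2 v = 0 → False := by
      intro u v hne h hu hv
      have := hal u (by rintro rfl; exact hne (hxr.symm.trans h))
      rw [h, hu, hv] at this
      simp [ColourAllowed] at this
    intro u v hu hv huv
    obtain ⟨hne, h | h⟩ := parentGraph_adj.1 huv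
    · exact key u v hne h hu hv
    · exact key v u hne.symm h hv hu
  · intro v hv
    have hv0 : x.2 v ≠ 0 := hv
    have h3 : x.2 v = 0 ∨ x.2 v = 1 ∨ x.2 v = 2 := by generalize x.2 v = a; revert a; decide
    rcases h3 with h | h | h
    · exact absurd h hv0
    · obtain ⟨w, hw, hwv, hw0⟩ := hx.dominated v (by simp [em']) h
      exact ⟨w, hw0, parentGraph_adj.2 ⟨by rintro rfl; exact hv0 hw0, Or.inr hwv⟩⟩
    · have hvr : v ≠ r := by rintro rfl; exact hr h
      have := hal v hvr
      refine ⟨x.1 v, ?_, parentGraph_adj.2 ⟨(parent_ne hx.acyclic hvr).symm, Or.inl rfl⟩⟩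
      rw [h] at this
      simpa [ColourAllowed] using this

lemma IsColouredForest.ext_of_parentGraph {r : V} {c₀ c₁ : V → Fin 3}
    {x y : (V → V) × (V → Fin 3)}
    (hx : IsColouredForest {r} (Finset.univ.erase r) c₀ x) (hxr : x.2 r ≠ 2)
    (hy : IsColouredForest {r} (Finset.univ.erase r) c₁ y) (hyr : y.2 r ≠ 2)
    (hG : parentGraph x.1 = parentGraph y.1) (hJ : ∀ v, x.2 v = 0 ↔ y.2 v = 0) : x = y := by
  have h1 : x.1 = y.1 := parentGraph_injective (hx.fix r (by simp)) hy.acyclic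
    (hy.fix r (by simp)) hG
  have key : ∀ (c₀ : V → Fin 3) (x : (V → V) × (V → Fin 3)),
      IsColouredForest {r} (Finset.univ.erase r) c₀ x → x.2 r ≠ 2 →
      ∀ v, x.2 v = 2 ↔ x.2 v ≠ 0 ∧ ∀ w, w ≠ r → x.1 w = v → x.2 w ≠ 0 := by
    intro c₀ x hx hr v
    constructor
    · intro h
      refine ⟨by rw [h]; decide, fun w hw hwv h0 => ?_⟩
      have := hx.allowed w (by simpa using hw)
      rw [hwv, h, h0] at this
      simp [ColourAllowed] at this
    · rintro ⟨h0, h⟩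
      have h3 : x.2 v = 0 ∨ x.2 v = 1 ∨ x.2 v = 2 := by generalize x.2 v = a; revert a; decide
      rcases h3 with h' | h' | h'
      · exact absurd h' h0
      · obtain ⟨w, hw, hwv, hw0⟩ := hx.dominated v (by simp [em']) h'
        exact absurd hw0 (h w (by simpa using hw) hwv)
      · exact h'
  refine Prod.ext h1 (funext fun v => ?_)
  have hx2 := key c₀ x hx hxr v
  have hy2 := key c₁ y hy hyr v
  simp only [h1, ne_eq, hJ] at hx2
  have h2 : x.2 v = 2 ↔ y.2 v = 2 := hx2.trans hy2.symm
  have h0 := hJ v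
  revert h0 h2
  generalize x.2 v = a
  generalize y.2 v = b
  revert a b
  decide

lemma exists_isColouredForest {r : V} {G : SimpleGraph V} (hG : G.IsTree) {J : Set V}
    (hJ : IsMaximalIndepSet G J) :
    ∃ x : (V → V) × (V → Fin 3), x.2 r ≠ 2 ∧
      IsColouredForest {r} (Finset.univ.erase r) (fun _ => x.2 r) x ∧
      parentGraph x.1 = G ∧ ∀ v, x.2 v = 0 ↔ v ∈ J := by
  classical
  obtain ⟨p, hac, hpr, rfl⟩ := exists_parentGraph_eq hG r
  rw [isMaximalIndepSet_iff] at hJ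
  obtain ⟨hind, hmax⟩ := hJ
  set c : V → Fin 3 := fun v => if v ∈ J then 0 else if ∃ w, w ≠ r ∧ p w = v ∧ w ∈ J then 1 else 2
    with hc
  have c0 : ∀ v, c v = 0 ↔ v ∈ J := by intro v; simp only [hc]; split_ifs <;> simp_all
  have c1 : ∀ v, c v = 1 ↔ v ∉ J ∧ ∃ w, w ≠ r ∧ p w = v ∧ w ∈ J := by
    intro v; simp only [hc]; split_ifs <;> simp_all
  have c2 : ∀ v, c v = 2 → v ≠ r ∧ p v ∈ J ∧ v ∉ J ∧ ∀ w, w ≠ r → p w = v → w ∉ J := by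
    intro v hv
    have h0 : v ∉ J := by rw [← c0, hv]; decide
    have h1 : ¬ ∃ w, w ≠ r ∧ p w = v ∧ w ∈ J := fun h => by
      have := (c1 v).2 ⟨h0, h⟩
      rw [hv] at this
      exact absurd this (by decide)
    obtain ⟨w, hw, hvw⟩ := hmax v h0
    push Not at h1
    obtain ⟨hne, h | h⟩ := parentGraph_adj.1 hvw
    · refine ⟨?_, h ▸ hw, h0, h1⟩
      rintro rfl
      exact hne (hpr.symm.trans h)
    · refine absurd hw (h1 w ?_ h)
      rintro rfl
      exact hne (h.symm.trans hpr)
  have hr : c r ≠ 2 := fun h => (c2 r h).1 rfl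
  refine ⟨(p, c), hr, ⟨fun v hv => ?_, fun v hv => ?_, fun v _ => ?_, hac, fun v hv => ?_,
    fun v _ h => ?_⟩, rfl, c0⟩
  · have : v = r := by simpa using hv
    rw [this]
    exact hpr
  · have : v = r := by simpa using hv
    rw [this]
  · simp [em']
  · have hvr : v ≠ r := by simpa using hv
    have hadj : (parentGraph p).Adj v (p v) :=
      parentGraph_adj.2 ⟨(parent_ne hac hvr).symm, Or.inl rfl⟩
    have h1 : ¬ (c v = 0 ∧ c (p v) = 0) := fun h => hind ((c0 v).1 h.1) ((c0 _).1 h.2) hadj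
    have h2 : c v = 2 → c (p v) = 0 := fun h => (c0 _).2 (c2 v h).2.1
    have h3 : c (p v) = 2 → c v ≠ 0 := fun h h' => (c2 _ h).2.2.2 v hvr rfl ((c0 v).1 h')
    change (c (p v) = 0 ∧ c v ≠ 0) ∨ (c (p v) = 1 ∧ c v ≠ 2) ∨ (c (p v) = 2 ∧ c v = 1)
    revert h1 h2 h3
    generalize c v = a
    generalize c (p v) = b
    revert a b
    decide
  · obtain ⟨-, w, hw, hwv, hwJ⟩ := (c1 v).1 h
    exact ⟨w, by simpa using hw, hwv, (c0 w).2 hwJ⟩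

lemma card_isTree_isMaximalIndepSet (r : V) :
    Nat.card {x : SimpleGraph V × Set V // x.1.IsTree ∧ IsMaximalIndepSet x.1 x.2} =
      (colouredForests {r} (Finset.univ.erase r) fun _ => 0).card +
      (colouredForests {r} (Finset.univ.erase r) fun _ => 1).card := by
  classical
  have hdisj : Disjoint (colouredForests {r} (Finset.univ.erase r) fun _ => 0)
      (colouredForests {r} (Finset.univ.erase r) fun _ => 1) := by
    rw [Finset.disjoint_left]
    intro x h0 h1
    rw [mem_colouredForests] at h0 h1
    have := (h0.col r (by simp)).symm.trans (h1.col r (by simp))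
    simp at this
  rw [← Finset.card_union_of_disjoint hdisj, ← Fintype.card_coe, ← Nat.card_eq_fintype_card]
  set Y := (colouredForests {r} (Finset.univ.erase r) fun _ => 0) ∪
    (colouredForests {r} (Finset.univ.erase r) fun _ => 1) with hY
  have hYmem : ∀ x ∈ Y, x.2 r ≠ 2 ∧
      IsColouredForest {r} (Finset.univ.erase r) (fun _ => x.2 r) x := by
    intro x hx
    rw [hY, Finset.mem_union, mem_colouredForests, mem_colouredForests] at hx
    rcases hx with hx | hx
    · have := hx.col r (by simp)
      rw [this]
      exact ⟨by decide, hx⟩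
    · have := hx.col r (by simp)
      rw [this]
      exact ⟨by decide, hx⟩
  symm
  refine Nat.card_eq_of_bijective (fun x : Y => ⟨(parentGraph x.1.1, {v | x.1.2 v = 0}),
    isTree_parentGraph (hYmem _ x.2).2.acyclic ((hYmem _ x.2).2.fix r (by simp)),
    (hYmem _ x.2).2.isMaximalIndepSet (hYmem _ x.2).1⟩) ⟨?_, ?_⟩
  · intro x y hxy
    simp only [Subtype.mk.injEq, Prod.mk.injEq] at hxy
    exact Subtype.ext ((hYmem _ x.2).2.ext_of_parentGraph (hYmem _ x.2).1 (hYmem _ y.2).2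
      (hYmem _ y.2).1 hxy.1 fun v => Set.ext_iff.1 hxy.2 v)
  · rintro ⟨⟨G, J⟩, hG, hJ⟩
    obtain ⟨x, hr, hx, rfl, hxJ⟩ := exists_isColouredForest (r := r) hG hJ
    refine ⟨⟨x, ?_⟩, ?_⟩
    · rw [hY, Finset.mem_union, mem_colouredForests, mem_colouredForests]
      have h3 : x.2 r = 0 ∨ x.2 r = 1 ∨ x.2 r = 2 := by generalize x.2 r = a; revert a; decide
      rcases h3 with h | h | h
      · left; rwa [h] at hx
      · right; rwa [h] at hx
      · exact absurd h hr
    · simp only [Subtype.mk.injEq, Prod.mk.injEq, true_and]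
      ext v
      exact hxJ v

end ParentGraph

section Coefficients

open Complex MeasureTheory

/-- Cauchy's integral for the `m`-th derivative of `g` at `0`, over the circle of radius `r`. -/
noncomputable def cauchyDeriv (r : ℝ) (m : ℕ) (g : ℂ → ℂ) : ℂ :=
  (m.factorial : ℂ) * ((2 * Real.pi * I)⁻¹ * ∮ z in C(0, r), g z / z ^ (m + 1))

variable {r : ℝ}

lemma ne_zero_of_mem_circle (hr : 0 < r) {z : ℂ} (hz : z ∈ Metric.sphere (0 : ℂ) r) : z ≠ 0 := by
  rintro rfl
  simp at hz
  exact hr.ne hz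

lemma circleIntegrable_div_pow (hr : 0 < r) {g : ℂ → ℂ} (hg : Differentiable ℂ g) (m : ℕ) :
    CircleIntegrable (fun z => g z / z ^ m) 0 r :=
  ContinuousOn.circleIntegrable hr.le <|
    hg.continuous.continuousOn.div (by fun_prop)
      fun _ hz => pow_ne_zero _ (ne_zero_of_mem_circle hr hz)

lemma cauchyDeriv_sub (hr : 0 < r) (m : ℕ) {f g : ℂ → ℂ} (hf : Differentiable ℂ f)
    (hg : Differentiable ℂ g) :
    cauchyDeriv r m (fun z => f z - g z) = cauchyDeriv r m f - cauchyDeriv r m g := by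
  simp only [cauchyDeriv, sub_div]
  rw [circleIntegral.integral_sub (circleIntegrable_div_pow hr hf _)
    (circleIntegrable_div_pow hr hg _)]
  ring

lemma cauchyDeriv_zero (hr : 0 < r) {g : ℂ → ℂ} (hg : Differentiable ℂ g) :
    cauchyDeriv r 0 g = g 0 := by
  have h := (hg.diffContOnCl (s := Metric.ball 0 r)).circleIntegral_sub_inv_smul
    (Metric.mem_ball_self hr)
  simp only [sub_zero, smul_eq_mul] at h
  have h2 : (2 * Real.pi * I : ℂ) ≠ 0 := two_pi_I_ne_zero
  simp only [cauchyDeriv, Nat.factorial_zero, Nat.cast_one, one_mul, zero_add, pow_one,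
    div_eq_inv_mul]
  rw [h, inv_mul_cancel_left₀ h2]

lemma hasSum_circleIntegral_exp_mul (hr : 0 < r) (m : ℕ) {y g : ℂ → ℂ}
    (hy : Differentiable ℂ y) (hg : Differentiable ℂ g) :
    HasSum (fun k : ℕ => ∮ z in C(0, r), (z * y z) ^ k / k.factorial * (g z / z ^ m))
      (∮ z in C(0, r), exp (z * y z) * (g z / z ^ m)) := by
  have hne : ∀ θ, circleMap 0 r θ ≠ 0 := fun θ => circleMap_ne_center hr.ne'
  have hyc := hy.continuous
  have hgc := hg.continuous
  have hc : Continuous (circleMap 0 r) := continuous_circleMap 0 r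
  have hq : Continuous fun θ => g (circleMap 0 r θ) / circleMap 0 r θ ^ m :=
    (hgc.comp hc).div (hc.pow m) fun θ => pow_ne_zero _ (hne θ)
  simp only [circleIntegral, deriv_circleMap]
  have hsum : ∀ θ : ℝ, HasSum (fun k : ℕ => ‖circleMap 0 r θ * I‖ *
      (‖circleMap 0 r θ * y (circleMap 0 r θ)‖ ^ k / k.factorial *
        ‖g (circleMap 0 r θ) / circleMap 0 r θ ^ m‖))
      (‖circleMap 0 r θ * I‖ * (Real.exp ‖circleMap 0 r θ * y (circleMap 0 r θ)‖ *
        ‖g (circleMap 0 r θ) / circleMap 0 r θ ^ m‖)) := by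
    intro θ
    have := NormedSpace.expSeries_div_hasSum_exp (𝔸 := ℝ) ‖circleMap 0 r θ * y (circleMap 0 r θ)‖
    rw [← Real.exp_eq_exp_ℝ] at this
    exact (this.mul_right _).mul_left _
  refine intervalIntegral.hasSum_integral_of_dominated_convergence
    (fun k θ => ‖circleMap 0 r θ * I‖ * (‖circleMap 0 r θ * y (circleMap 0 r θ)‖ ^ k / k.factorial *
      ‖g (circleMap 0 r θ) / circleMap 0 r θ ^ m‖)) ?_ ?_ ?_ ?_ ?_
  · intro k
    refine Continuous.aestronglyMeasurable ?_
    exact (hc.mul continuous_const).smul ((((hc.mul (hyc.comp hc)).pow k).div_const _).mul hq)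
  · intro k
    refine Filter.Eventually.of_forall fun θ _ => le_of_eq ?_
    simp only [norm_smul, norm_mul, norm_div, norm_pow, norm_natCast]
  · exact Filter.Eventually.of_forall fun θ _ => (hsum θ).summable
  · simp only [fun θ => (hsum θ).tsum_eq]
    refine Continuous.intervalIntegrable ?_ _ _
    exact (hc.mul continuous_const).norm.mul
      ((Real.continuous_exp.comp (hc.mul (hyc.comp hc)).norm).mul hq.norm)
  · refine Filter.Eventually.of_forall fun θ _ => ?_
    have := NormedSpace.expSeries_div_hasSum_exp (𝔸 := ℂ) (circleMap 0 r θ * y (circleMap 0 r θ))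
    rw [← Complex.exp_eq_exp_ℂ] at this
    simp only [smul_eq_mul]
    exact (this.mul_right _).mul_left _

/-- The exponential formula. -/
lemma sum_powerset_cauchyDeriv {V : Type*} [DecidableEq V] (hr : 0 < r) (U : Finset V)
    {y g : ℂ → ℂ} (hy : Differentiable ℂ y) (hg : Differentiable ℂ g) :
    ∑ S ∈ U.powerset, cauchyDeriv r (U \ S).card (fun z => y z ^ S.card * g z) =
      cauchyDeriv r U.card (fun z => exp (z * y z) * g z) := by
  have h1 : ∀ S ∈ U.powerset, cauchyDeriv r (U \ S).card (fun z => y z ^ S.card * g z) =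
      (fun k => cauchyDeriv r (U.card - k) (fun z => y z ^ k * g z)) S.card := by
    intro S hS
    rw [Finset.card_sdiff_of_subset (Finset.mem_powerset.1 hS)]
  rw [Finset.sum_congr rfl h1, Finset.sum_powerset_apply_card
    (fun k => cauchyDeriv r (U.card - k) (fun z => y z ^ k * g z))]
  generalize U.card = m
  have h2 := hasSum_circleIntegral_exp_mul hr (m + 1) hy hg
  have h3 : ∀ k ∉ Finset.range (m + 1),
      (∮ z in C(0, r), (z * y z) ^ k / k.factorial * (g z / z ^ (m + 1))) = 0 := by
    intro k hk
    rw [Finset.mem_range, not_lt] at hk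
    have hd : Differentiable ℂ fun z => z ^ (k - (m + 1)) * y z ^ k / k.factorial * g z := by
      fun_prop
    have h0 := (hd.diffContOnCl (s := Metric.ball 0 r)).circleIntegral_eq_zero hr.le
    refine Eq.trans ?_ h0
    refine circleIntegral.integral_congr hr.le fun z hz => ?_
    have hz0 := ne_zero_of_mem_circle hr hz
    have : z ^ k = z ^ (k - (m + 1)) * z ^ (m + 1) := by rw [← pow_add, Nat.sub_add_cancel hk]
    simp only [mul_pow, this]
    field_simp
  have h4 := h2.unique (hasSum_sum_of_ne_finset_zero h3)
  have h5 : cauchyDeriv r m (fun z => exp (z * y z) * g z) = (m.factorial : ℂ) *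
      ((2 * Real.pi * I)⁻¹ * ∮ z in C(0, r), exp (z * y z) * (g z / z ^ (m + 1))) := by
    simp only [cauchyDeriv, mul_div_assoc]
  rw [h5, h4, Finset.mul_sum, Finset.mul_sum]
  refine Finset.sum_congr rfl fun k hk => ?_
  have hk : k ≤ m := Nat.lt_succ_iff.1 (Finset.mem_range.1 hk)
  have h6 : (∮ z in C(0, r), (z * y z) ^ k / k.factorial * (g z / z ^ (m + 1))) =
      (k.factorial : ℂ)⁻¹ * ∮ z in C(0, r), y z ^ k * g z / z ^ (m - k + 1) := by
    rw [← circleIntegral.integral_const_mul]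
    refine circleIntegral.integral_congr hr.le fun z hz => ?_
    have hz0 := ne_zero_of_mem_circle hr hz
    have : z ^ (m + 1) = z ^ (m - k + 1) * z ^ k := by rw [← pow_add]; congr 1; omega
    simp only [mul_pow, this]
    field_simp
  rw [h6, cauchyDeriv, nsmul_eq_mul]
  have hc : (m.choose k : ℂ) * (m - k).factorial * k.factorial = m.factorial := by
    have := Nat.choose_mul_factorial_mul_factorial hk
    rw [← this]
    push_cast
    ring
  have hk0 : (k.factorial : ℂ) ≠ 0 := by exact_mod_cast k.factorial_ne_zero
  rw [← hc]
  field_simp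

end Coefficients

section Counting

open Complex

/-- The generating function of the branches at a dominated vertex outside of the independent set,
in terms of that of the branches at a vertex which is not dominated. -/
noncomputable def branchFun (z : ℂ) : ℂ := exp (z * exp z) - 1

/-- The derivative of `z * branchFun z`. -/
noncomputable def branchDeriv (z : ℂ) : ℂ :=
  branchFun z + z * ((1 + z) * exp z * exp (z * exp z))

/-- The integrand whose derivatives at `0` count coloured forests with `N` vertices, of which `a`
roots have colour `0` and `b` roots have colour `1`. -/
noncomputable def forestFun (a b N : ℕ) (z : ℂ) : ℂ :=
  exp z ^ a * (branchFun z ^ b * (exp (z * branchFun z) ^ N * (1 - z * branchDeriv z)))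

lemma differentiable_branchFun : Differentiable ℂ branchFun := by
  unfold branchFun; fun_prop

lemma differentiable_branchDeriv : Differentiable ℂ branchDeriv := by
  have := differentiable_branchFun
  unfold branchDeriv; fun_prop

lemma differentiable_forestFun (a b N : ℕ) : Differentiable ℂ (forestFun a b N) := by
  have := differentiable_branchFun
  have := differentiable_branchDeriv
  unfold forestFun; fun_prop

lemma hasDerivAt_mul_branchFun (z : ℂ) :
    HasDerivAt (fun z => z * branchFun z) (branchDeriv z) z := by
  have h1 : HasDerivAt (fun z : ℂ => z * exp z) (1 * exp z + z * exp z) z :=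
    (hasDerivAt_id z).mul (hasDerivAt_exp z)
  have h2 := (hasDerivAt_id z).mul (h1.cexp.sub_const 1)
  refine h2.congr_deriv ?_
  simp only [branchDeriv, branchFun, id]
  ring

lemma hasDerivAt_exp_mul_branchFun_div_pow (n : ℕ) {z : ℂ} (hz : z ≠ 0) :
    HasDerivAt (fun z => (exp (z * branchFun z) / z) ^ n)
      (-(n : ℂ) * (exp (z * branchFun z) ^ n * (1 - z * branchDeriv z) / z ^ (n + 1))) z := by
  have h := ((hasDerivAt_mul_branchFun z).cexp.div (hasDerivAt_id z) hz).pow n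
  refine h.congr_deriv ?_
  rcases n with _ | n
  · simp
  · simp only [Nat.add_sub_cancel, Nat.cast_add, Nat.cast_one, Pi.div_apply, id, div_pow]
    field_simp
    ring

variable {r : ℝ}

lemma cauchyDeriv_forestFun_zero (hr : 0 < r) {m : ℕ} (hm : m ≠ 0) :
    cauchyDeriv r m (forestFun 0 0 m) = 0 := by
  have h : (∮ z in C(0, r), -(m : ℂ) *
      (exp (z * branchFun z) ^ m * (1 - z * branchDeriv z) / z ^ (m + 1))) = 0 :=
    circleIntegral.integral_eq_zero_of_hasDerivWithinAt hr.le fun z hz =>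
      (hasDerivAt_exp_mul_branchFun_div_pow m (ne_zero_of_mem_circle hr hz)).hasDerivWithinAt
  rw [circleIntegral.integral_const_mul] at h
  have h2 := (mul_eq_zero.1 h).resolve_left (by simpa using hm)
  simp only [cauchyDeriv, forestFun, pow_zero, one_mul, h2, mul_zero]

section

variable {V : Type*} [DecidableEq V]

lemma card_filter_recolour {R U A B C : Finset V} {c₀ : V → Fin 3} (hd : Disjoint R U)
    (hAU : A ⊆ U) (hBU : B ⊆ U \ A) (hCU : C ⊆ (U \ A) \ B) :
    ((R ∪ (A ∪ B ∪ C)).filter fun v => recolour c₀ A B C v = 0).card =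
        (R.filter fun v => c₀ v = 0).card + A.card ∧
    ((R ∪ (A ∪ B ∪ C)).filter fun v => recolour c₀ A B C v = 1).card =
        (R.filter fun v => c₀ v = 1).card + B.card ∧
    (R ∪ (A ∪ B ∪ C)).card + ((((U \ A) \ B) \ C)).card = R.card + U.card := by
  have hBU' : ∀ v ∈ B, v ∈ U ∧ v ∉ A := fun v hv => by simpa using hBU hv
  have hCU' : ∀ v ∈ C, v ∈ U ∧ v ∉ A ∧ v ∉ B := fun v hv => by
    simpa [and_assoc] using hCU hv
  have hRU : ∀ v ∈ R, v ∉ U := fun v hv => Finset.disjoint_left.1 hd hv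
  have hRA : ∀ v ∈ R, v ∉ A := fun v hv h => hRU v hv (hAU h)
  have hRB : ∀ v ∈ R, v ∉ B := fun v hv h => hRU v hv (hBU' v h).1
  have hRC : ∀ v ∈ R, v ∉ C := fun v hv h => hRU v hv (hCU' v h).1
  refine ⟨?_, ?_, ?_⟩
  · rw [← Finset.card_union_of_disjoint]
    · congr 1
      ext v
      simp only [Finset.mem_filter, Finset.mem_union, recolour]
      grind
    · rw [Finset.disjoint_left]
      intro v hv
      exact hRA v (Finset.mem_filter.1 hv).1
  · rw [← Finset.card_union_of_disjoint]
    · congr 1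
      ext v
      simp only [Finset.mem_filter, Finset.mem_union, recolour]
      grind
    · rw [Finset.disjoint_left]
      intro v hv
      exact hRB v (Finset.mem_filter.1 hv).1
  · rw [← Finset.card_union_of_disjoint, ← Finset.card_union_of_disjoint hd]
    · congr 1
      ext v
      simp only [Finset.mem_sdiff, Finset.mem_union]
      grind
    · rw [Finset.disjoint_left]
      intro v hv
      simp only [Finset.mem_sdiff, Finset.mem_union] at *
      grind

lemma forestFun_add (a b i j N : ℕ) (z : ℂ) :
    forestFun (a + i) (b + j) N z = exp z ^ i * (branchFun z ^ j * forestFun a b N z) := by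
  simp only [forestFun, pow_add]
  ring

open Classical in
/-- The sum over the sets of children of a root coloured `k`. -/
lemma sum_childrenAllowed (hr : 0 < r) (U : Finset V) (a b N : ℕ) (k : Fin 3) :
    (∑ A ∈ U.powerset, ∑ B ∈ (U \ A).powerset, ∑ C ∈ ((U \ A) \ B).powerset,
      if ChildrenAllowed k A C then
        cauchyDeriv r (((U \ A) \ B) \ C).card (forestFun (a + A.card) (b + B.card) N) else 0) =
    cauchyDeriv r U.card (forestFun (if k = 0 then a + 1 else a) (if k = 1 then b + 1 else b)
      (N + 1)) := by
  have hβ := differentiable_branchFun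
  have hβ' : ∀ z : ℂ, exp (z * exp z) = branchFun z + 1 := fun z => by simp [branchFun]
  have hF := differentiable_forestFun
  have h3 : k = 0 ∨ k = 1 ∨ k = 2 := by revert k; decide
  have hB : ∀ U : Finset V, ∀ g : ℂ → ℂ, Differentiable ℂ g →
      ∑ B ∈ U.powerset, cauchyDeriv r (U \ B).card (fun z => branchFun z ^ B.card * g z) =
      cauchyDeriv r U.card (fun z => exp (z * branchFun z) * g z) := fun U g hg =>
    sum_powerset_cauchyDeriv hr U hβ hg
  simp only [show ∀ i j, forestFun (a + i) (b + j) N =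
    fun z => exp z ^ i * (branchFun z ^ j * forestFun a b N z) from
      fun i j => funext fun z => forestFun_add a b i j N z]
  rcases h3 with rfl | rfl | rfl
  · rw [Finset.sum_eq_single_of_mem ∅ (Finset.empty_mem_powerset U)]
    · have hC : ∀ U : Finset V, ∀ g : ℂ → ℂ, Differentiable ℂ g →
          ∑ C ∈ U.powerset, cauchyDeriv r (U \ C).card g =
          cauchyDeriv r U.card (fun z => exp z * g z) := fun U g hg => by
        simpa using sum_powerset_cauchyDeriv hr U (y := fun _ => 1) (by fun_prop) hg
      simp only [ChildrenAllowed, Finset.sdiff_empty, Finset.card_empty, pow_zero, one_mul,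
        true_and, true_or, if_true]
      have : ∀ B ∈ U.powerset, ∑ C ∈ (U \ B).powerset, cauchyDeriv r ((U \ B) \ C).card
          (fun z => branchFun z ^ B.card * forestFun a b N z) =
          cauchyDeriv r (U \ B).card
            (fun z => branchFun z ^ B.card * (exp z * forestFun a b N z)) := by
        intro B _
        rw [hC _ _ (by fun_prop)]
        congr 1
        ext z
        ring
      rw [Finset.sum_congr rfl this, hB U _ (by fun_prop)]
      congr 1
      ext z
      simp only [forestFun]
      simp
      ring
    · intro A _ hA
      simp [ChildrenAllowed, hA]
  · have hC : ∀ A B : Finset V, (∑ C ∈ ((U \ A) \ B).powerset, if ChildrenAllowed 1 A C then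
        cauchyDeriv r (((U \ A) \ B) \ C).card
          (fun z => exp z ^ A.card * (branchFun z ^ B.card * forestFun a b N z)) else 0) =
        if A = ∅ then 0 else cauchyDeriv r ((U \ A) \ B).card
          (fun z => branchFun z ^ B.card * (exp z ^ A.card * forestFun a b N z)) := by
      intro A B
      rw [Finset.sum_eq_single_of_mem ∅ (Finset.empty_mem_powerset _)]
      · simp only [ChildrenAllowed, Finset.sdiff_empty]
        simp [mul_left_comm, ite_not]
      · intro C _ hC
        simp [ChildrenAllowed, hC]
    simp only [hC]
    have hA : ∀ A ∈ U.powerset, (∑ B ∈ (U \ A).powerset, if A = ∅ then 0 else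
        cauchyDeriv r ((U \ A) \ B).card
          (fun z => branchFun z ^ B.card * (exp z ^ A.card * forestFun a b N z))) =
        cauchyDeriv r (U \ A).card
          (fun z => exp z ^ A.card * (exp (z * branchFun z) * forestFun a b N z)) -
        if A = ∅ then cauchyDeriv r U.card
          (fun z => exp (z * branchFun z) * forestFun a b N z) else 0 := by
      intro A _
      by_cases h : A = ∅
      · simp [h]
      · simp only [h, if_false, sub_zero]
        rw [hB _ _ (by fun_prop)]
        congr 1
        ext z
        ring
    rw [Finset.sum_congr rfl hA, Finset.sum_sub_distrib,
      sum_powerset_cauchyDeriv hr U (by fun_prop) (by fun_prop), Finset.sum_ite_eq',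
      if_pos (Finset.empty_mem_powerset U), ← cauchyDeriv_sub hr _ (by fun_prop) (by fun_prop)]
    congr 1
    ext z
    simp only [hβ', forestFun]
    simp
    ring
  · rw [Finset.sum_eq_single_of_mem ∅ (Finset.empty_mem_powerset U)]
    · have hC : ∀ B : Finset V, (∑ C ∈ ((U \ ∅) \ B).powerset, if ChildrenAllowed 2 ∅ C then
          cauchyDeriv r (((U \ ∅) \ B) \ C).card
            (fun z => exp z ^ (∅ : Finset V).card *
              (branchFun z ^ B.card * forestFun a b N z)) else 0) =
          cauchyDeriv r (U \ B).card
            (fun z => branchFun z ^ B.card * forestFun a b N z) := by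
        intro B
        rw [Finset.sum_eq_single_of_mem ∅ (Finset.empty_mem_powerset _)]
        · simp [ChildrenAllowed]
        · intro C _ hC
          simp [ChildrenAllowed, hC]
      simp only [hC]
      rw [Finset.sdiff_empty, hB _ _ (by fun_prop)]
      congr 1
      ext z
      simp only [forestFun]
      simp
      ring
    · intro A _ hA
      simp [ChildrenAllowed, hA]

variable [Fintype V]

lemma card_colouredForests_empty_empty (c₀ : V → Fin 3) :
    (colouredForests ∅ ∅ c₀).card = 1 := by
  rw [Finset.card_eq_one]
  refine ⟨(id, c₀), ?_⟩
  ext x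
  rw [mem_colouredForests, Finset.mem_singleton]
  constructor
  · intro h
    exact Prod.ext (funext fun v => h.fix v (by simp)) (funext fun v => h.col v (by simp))
  · rintro rfl
    constructor <;> simp

lemma card_colouredForests_empty {U : Finset V} (hU : U ≠ ∅) (c₀ : V → Fin 3) :
    (colouredForests ∅ U c₀).card = 0 := by
  rw [Finset.card_eq_zero, Finset.eq_empty_iff_forall_notMem]
  intro x hx
  rw [mem_colouredForests] at hx
  exact hU (hx.acyclic U subset_rfl fun v hv => by simpa using hx.mem v hv)

/-- The number of coloured forests as a Cauchy integral. -/
theorem card_colouredForests_eq_cauchyDeriv (hr : 0 < r) (N : ℕ) :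
    ∀ (R U : Finset V) (c₀ : V → Fin 3), Disjoint R U → R.card + U.card = N →
      ((colouredForests R U c₀).card : ℂ) = cauchyDeriv r U.card
        (forestFun (R.filter fun v => c₀ v = 0).card (R.filter fun v => c₀ v = 1).card N) := by
  induction N with
  | zero =>
    intro R U c₀ _ hN
    obtain rfl : R = ∅ := Finset.card_eq_zero.1 (by omega)
    obtain rfl : U = ∅ := Finset.card_eq_zero.1 (by omega)
    rw [card_colouredForests_empty_empty, Finset.card_empty,
      cauchyDeriv_zero hr (differentiable_forestFun _ _ _)]
    simp [forestFun]
  | succ N ih =>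
    intro R U c₀ hd hN
    rcases R.eq_empty_or_nonempty with rfl | ⟨v, hv⟩
    · have hU : U.card = N + 1 := by simpa using hN
      have hU' : U ≠ ∅ := by rintro rfl; simp at hU
      rw [card_colouredForests_empty hU', hU]
      simpa using (cauchyDeriv_forestFun_zero hr (Nat.succ_ne_zero N)).symm
    · have hd' : Disjoint (R.erase v) U := hd.mono_left (Finset.erase_subset _ _)
      rw [card_colouredForests hd hv]
      push_cast
      have hR : ∀ k, (R.filter fun w => c₀ w = k).card = if c₀ v = k then
          ((R.erase v).filter fun w => c₀ w = k).card + 1 else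
          ((R.erase v).filter fun w => c₀ w = k).card := by
        intro k
        conv_lhs => rw [← Finset.insert_erase hv]
        rw [Finset.filter_insert]
        split_ifs
        · rw [Finset.card_insert_of_notMem (by simp)]
        · rfl
      rw [hR, hR, ← sum_childrenAllowed hr U _ _ N (c₀ v)]
      refine Finset.sum_congr rfl fun A hA => Finset.sum_congr rfl fun B hB =>
        Finset.sum_congr rfl fun C hC => ?_
      rw [Finset.mem_powerset] at hA hB hC
      split_ifs with hok
      · obtain ⟨h1, h2, h3⟩ := card_filter_recolour (c₀ := c₀) hd' hA hB hC
        have hRc := Finset.card_erase_add_one hv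
        rw [ih _ _ _ ?_ (by rw [h3]; omega), h1, h2]
        rw [Finset.disjoint_left] at hd' ⊢
        intro w hw
        simp only [Finset.mem_sdiff, Finset.mem_union] at *
        have := @hd' w
        tauto
      · rfl

end

/-- The number of pairs of a tree and a maximal independent set as a Cauchy integral. -/
lemma tN_eq_cauchyDeriv (hr : 0 < r) (m : ℕ) :
    (tN (m + 1) : ℂ) = cauchyDeriv r m (forestFun 1 0 (m + 1)) +
      cauchyDeriv r m (forestFun 0 1 (m + 1)) := by
  have hU : (Finset.univ.erase (0 : Fin (m + 1))).card = m := by simp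
  have hd : Disjoint {(0 : Fin (m + 1))} (Finset.univ.erase 0) := by simp
  have hN : ({(0 : Fin (m + 1))} : Finset _).card + (Finset.univ.erase (0 : Fin (m + 1))).card =
      m + 1 := by rw [hU, Finset.card_singleton, add_comm]
  have h := card_isTree_isMaximalIndepSet (0 : Fin (m + 1))
  rw [tN, h]
  push_cast
  rw [card_colouredForests_eq_cauchyDeriv hr (m + 1) _ _ _ hd hN,
    card_colouredForests_eq_cauchyDeriv hr (m + 1) _ _ _ hd hN, hU]
  simp [Finset.filter_singleton]

end Counting

section Laplace

open Complex MeasureTheory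

/-- Laplace's method at an interior point: the exponent `f` has a strict quadratic maximum of its
real part at `0`. -/
lemma tendsto_sqrt_mul_integral_exp {P f : ℝ → ℂ} {g : ℂ} {κ : ℝ} (hκ : 0 < κ)
    (hP : Continuous P) (hf : Continuous f)
    (hbound : ∀ θ : ℝ, |θ| ≤ Real.pi → (f θ).re ≤ -κ * θ ^ 2)
    (hg : Tendsto (fun θ : ℝ => f θ / (θ : ℂ) ^ 2) (𝓝[≠] 0) (𝓝 g)) :
    Tendsto (fun n : ℕ => (Real.sqrt n : ℂ) *
        ∫ θ in (-Real.pi)..Real.pi, P θ * exp (n * f θ)) atTop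
      (𝓝 (P 0 * ∫ t : ℝ, exp (g * (t : ℂ) ^ 2))) := by
  set S := Set.Ioc (-Real.pi) Real.pi with hS
  have hS0 : S ∈ 𝓝 (0 : ℝ) := Ioc_mem_nhds (by linarith [Real.pi_pos]) Real.pi_pos
  have hscale : ∀ n : ℕ, (Real.sqrt n : ℂ) *
      ∫ θ in (-Real.pi)..Real.pi, P θ * exp (n * f θ) =
      ∫ t : ℝ, S.indicator (fun θ => P θ * exp (n * f θ)) (t / Real.sqrt n) := by
    intro n
    rw [Measure.integral_comp_div (S.indicator fun θ => P θ * exp (n * f θ)),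
      abs_of_nonneg (Real.sqrt_nonneg _), integral_indicator measurableSet_Ioc,
      intervalIntegral.integral_of_le (by linarith [Real.pi_pos]), real_smul]
  simp only [hscale]
  rw [← integral_const_mul]
  obtain ⟨M, hM⟩ := (isCompact_Icc (a := -Real.pi) (b := Real.pi)).exists_bound_of_continuousOn
    hP.continuousOn
  have hM0 : 0 ≤ M := (norm_nonneg _).trans (hM 0 ⟨by linarith [Real.pi_pos], Real.pi_pos.le⟩)
  have htend : ∀ t : ℝ, Tendsto (fun n : ℕ => t / Real.sqrt n) atTop (𝓝 0) := fun t =>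
    (Real.tendsto_sqrt_atTop.comp tendsto_natCast_atTop_atTop).const_div_atTop t
  refine tendsto_integral_filter_of_dominated_convergence
    (fun t => M * Real.exp (-κ * t ^ 2)) ?_ ?_ ((integrable_exp_neg_mul_sq hκ).const_mul M) ?_
  · refine Eventually.of_forall fun n => ?_
    have h1 : Continuous fun θ : ℝ => P θ * exp (n * f θ) := by fun_prop
    have h2 : StronglyMeasurable (S.indicator fun θ => P θ * exp (n * f θ)) :=
      h1.stronglyMeasurable.indicator measurableSet_Ioc
    exact (h2.comp_measurable (measurable_id.div_const _)).aestronglyMeasurable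
  · filter_upwards [eventually_gt_atTop 0] with n hn
    refine Eventually.of_forall fun t => ?_
    by_cases ht : t / Real.sqrt n ∈ S
    · rw [Set.indicator_of_mem ht, norm_mul, norm_exp]
      have hn' : (0 : ℝ) < n := by exact_mod_cast hn
      have h1 := hbound (t / Real.sqrt n) (abs_le.2 ⟨ht.1.le, ht.2⟩)
      rw [div_pow, Real.sq_sqrt hn'.le] at h1
      refine mul_le_mul (hM _ ⟨ht.1.le, ht.2⟩) (Real.exp_le_exp.2 ?_) (Real.exp_nonneg _) hM0
      have h2 : ((n : ℂ) * f (t / Real.sqrt n)).re = n * (f (t / Real.sqrt n)).re := by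
        rw [← ofReal_natCast, re_ofReal_mul]
      rw [h2]
      calc n * (f (t / Real.sqrt n)).re ≤ n * (-κ * (t ^ 2 / n)) := by gcongr
        _ = -κ * t ^ 2 := by field_simp
    · rw [Set.indicator_of_notMem ht, norm_zero]
      positivity
  · have hae : ∀ᵐ t : ℝ, t ≠ 0 := by simp [ae_iff]
    filter_upwards [hae] with t ht
    have hne : Tendsto (fun n : ℕ => t / Real.sqrt n) atTop (𝓝[≠] 0) := by
      refine tendsto_nhdsWithin_iff.2 ⟨htend t, ?_⟩
      filter_upwards [eventually_gt_atTop 0] with n hn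
      have hn' : (0 : ℝ) < n := by exact_mod_cast hn
      exact div_ne_zero ht (Real.sqrt_pos.2 hn').ne'
    have h1 : Tendsto (fun n : ℕ => (f (t / Real.sqrt n) / ((t / Real.sqrt n : ℝ) : ℂ) ^ 2) *
        (t : ℂ) ^ 2) atTop (𝓝 (g * (t : ℂ) ^ 2)) := (hg.comp hne).mul_const _
    have h2 : Tendsto (fun n : ℕ => P (t / Real.sqrt n)) atTop (𝓝 (P 0)) :=
      (hP.tendsto 0).comp (htend t)
    refine (h2.mul h1.cexp).congr' ?_
    filter_upwards [eventually_gt_atTop 0, (htend t).eventually hS0] with n hn hmem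
    have hn' : (0 : ℝ) < n := by exact_mod_cast hn
    rw [Set.indicator_of_mem (show t / Real.sqrt n ∈ S from hmem)]
    congr 2
    have h3 : (((t / Real.sqrt n : ℝ) : ℂ)) ^ 2 = (t : ℂ) ^ 2 / n := by
      rw [← ofReal_pow, div_pow, Real.sq_sqrt hn'.le]
      push_cast
      rfl
    have h4 : (n : ℂ) ≠ 0 := by exact_mod_cast hn.ne'
    have h5 : (t : ℂ) ≠ 0 := by exact_mod_cast ht
    rw [h3]
    field_simp

/-- An entire function vanishing to second order at `0` has a second order quotient. -/
lemma exists_tendsto_div_sq {F : ℂ → ℂ} (hF : Differentiable ℂ F) (h0 : F 0 = 0)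
    (h1 : deriv F 0 = 0) :
    ∃ g : ℂ, Tendsto (fun w => F w / w ^ 2) (𝓝[≠] 0) (𝓝 g) := by
  have hd : ∀ {F : ℂ → ℂ}, Differentiable ℂ F → Differentiable ℂ (dslope F 0) := fun h =>
    differentiableOn_univ.1 ((differentiableOn_dslope univ_mem).2 h.differentiableOn)
  have hK := hd (hd hF)
  refine ⟨_, (hK.continuous.tendsto 0).mono_left nhdsWithin_le_nhds |>.congr' ?_⟩
  filter_upwards [self_mem_nhdsWithin] with w hw
  have hw' : w ≠ 0 := hw
  have e1 := sub_smul_dslope (dslope F 0) 0 w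
  have e2 := sub_smul_dslope F 0 w
  rw [dslope_same, h1, sub_zero, sub_zero, smul_eq_mul] at e1
  rw [h0, sub_zero, sub_zero, smul_eq_mul, ← e1] at e2
  rw [← e2]
  field_simp

end Laplace

section Estimates

open Complex

lemma norm_exp_sub_one_sub_le {w : ℂ} {s : ℝ} (h : ‖w‖ ≤ s) :
    ‖exp w - 1 - w‖ ≤ Real.exp s - 1 - s := by
  have h1 := norm_exp_sub_sum_le_exp_norm_sub_sum w 2
  simp only [Finset.sum_range_succ, Finset.sum_range_zero, pow_zero, pow_one, Nat.factorial_zero,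
    Nat.factorial_one, Nat.cast_one, div_one, zero_add] at h1
  have h2 : Real.exp s = Real.exp ‖w‖ * Real.exp (s - ‖w‖) := by
    rw [← Real.exp_add]; congr 1; ring
  have h3 := Real.add_one_le_exp (s - ‖w‖)
  have h4 := Real.one_le_exp (norm_nonneg w)
  rw [← sub_sub] at h1
  nlinarith

/-- The restriction of `z * branchFun z` to the real line. -/
noncomputable def realExponent (u : ℝ) : ℝ := u * (Real.exp (u * Real.exp u) - 1)

lemma ofReal_realExponent (u : ℝ) : (realExponent u : ℂ) = u * branchFun u := by
  simp [realExponent, branchFun]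

lemma re_mul_branchFun_le {r : ℝ} (hr0 : 0 < r) (hr1 : r ≤ 1) {θ : ℝ} (hθ : |θ| ≤ Real.pi) :
    (r * exp (θ * I) * branchFun (r * exp (θ * I))).re ≤
      realExponent r - 3 * r ^ 3 / (2 * Real.pi ^ 2) * θ ^ 2 := by
  set z : ℂ := r * exp (θ * I) with hz
  have hzn : ‖z‖ = r := by
    rw [hz, norm_mul, norm_exp_ofReal_mul_I, norm_real, Real.norm_of_nonneg hr0.le, mul_one]
  have hwn : ‖z * exp z‖ ≤ r * Real.exp r := by
    rw [norm_mul, hzn, norm_exp]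
    gcongr
    exact (re_le_norm z).trans hzn.le
  have hdecomp : z * branchFun z = z ^ 2 + z ^ 3 + (z ^ 2 * (exp z - 1 - z) +
      z * (exp (z * exp z) - 1 - z * exp z)) := by
    rw [branchFun]; ring
  have hrem : (z ^ 2 * (exp z - 1 - z) + z * (exp (z * exp z) - 1 - z * exp z)).re ≤
      r ^ 2 * (Real.exp r - 1 - r) +
        r * (Real.exp (r * Real.exp r) - 1 - r * Real.exp r) := by
    refine (re_le_norm _).trans ((norm_add_le _ _).trans ?_)
    rw [norm_mul, norm_mul, norm_pow, hzn]
    gcongr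
    · exact norm_exp_sub_one_sub_le hzn.le
    · exact norm_exp_sub_one_sub_le hwn
  have hre : z.re = r * Real.cos θ := by
    rw [hz, re_ofReal_mul, exp_ofReal_mul_I_re]
  have him : z.im = r * Real.sin θ := by
    rw [hz, im_ofReal_mul, exp_ofReal_mul_I_im]
  have hs := Real.sin_sq_add_cos_sq θ
  have hz2 : (z ^ 2 + z ^ 3).re = r ^ 2 * (2 * Real.cos θ ^ 2 - 1) +
      r ^ 3 * (4 * Real.cos θ ^ 3 - 3 * Real.cos θ) := by
    have : Real.sin θ ^ 2 = 1 - Real.cos θ ^ 2 := by linarith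
    simp only [pow_succ, pow_zero, one_mul, add_re, mul_re, mul_im, hre, him]
    linear_combination (-r ^ 2 - 3 * r ^ 3 * Real.cos θ) * this
  have hcos := Real.cos_le_one_sub_mul_cos_sq hθ
  have hc1 := Real.cos_le_one θ
  have hc2 := Real.neg_one_le_cos θ
  rw [hdecomp, add_re, hz2]
  set c := Real.cos θ
  have hpoly : 3 / 4 * r ^ 3 * (1 - c) ≤
      (1 - c) * (2 * r ^ 2 * (1 + c) + r ^ 3 * (1 + 2 * c) ^ 2) := by
    have h32 : r ^ 3 ≤ r ^ 2 := pow_le_pow_of_le_one hr0.le hr1 (by norm_num)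
    have h3 : 0 < r ^ 3 := by positivity
    have : 3 / 4 * r ^ 3 ≤ 2 * r ^ 2 * (1 + c) + r ^ 3 * (1 + 2 * c) ^ 2 := by
      nlinarith [mul_nonneg h3.le (sq_nonneg (c + 3 / 4)), mul_nonneg (sub_nonneg.2 h32)
        (by linarith : 0 ≤ 1 + c)]
    rw [mul_comm]
    exact mul_le_mul_of_nonneg_left this (by linarith)
  have hκ : 3 * r ^ 3 / (2 * Real.pi ^ 2) * θ ^ 2 ≤ 3 / 4 * r ^ 3 * (1 - c) := by
    have : 3 * r ^ 3 / (2 * Real.pi ^ 2) * θ ^ 2 =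
        3 / 4 * r ^ 3 * (2 / Real.pi ^ 2 * θ ^ 2) := by ring
    rw [this]
    gcongr
    linarith
  have hreal : realExponent r = r ^ 2 + r ^ 3 + (r ^ 2 * (Real.exp r - 1 - r) +
        r * (Real.exp (r * Real.exp r) - 1 - r * Real.exp r)) := by
    rw [realExponent]; ring
  rw [hreal]
  linarith

/-- The saddle point. -/
lemma exists_mul_branchDeriv_eq_one :
    ∃ r : ℝ, 0 < r ∧ r ≤ 1 ∧ (r : ℂ) * branchDeriv r = 1 := by
  let d : ℝ → ℝ := fun u => u * (Real.exp (u * Real.exp u) - 1 +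
    u * ((1 + u) * Real.exp u * Real.exp (u * Real.exp u)))
  have hd : Continuous d := by fun_prop
  have hd1 : 1 ≤ d 1 := by
    have h1 : 1 ≤ Real.exp 1 := Real.one_le_exp zero_le_one
    have h2 : 1 ≤ Real.exp (1 * Real.exp 1) := Real.one_le_exp (by linarith)
    simp only [d]
    nlinarith [mul_nonneg (sub_nonneg.2 h1) (sub_nonneg.2 h2)]
  obtain ⟨r, ⟨h0, h1⟩, hr⟩ := intermediate_value_Icc zero_le_one hd.continuousOn
    (⟨by simp [d], hd1⟩ : (1 : ℝ) ∈ Set.Icc (d 0) (d 1))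
  refine ⟨r, h0.lt_of_ne ?_, h1, ?_⟩
  · rintro rfl
    simp [d] at hr
  · rw [← ofReal_one, ← hr]
    simp [d, branchDeriv, branchFun]

lemma mul_exp_neg_realExponent_lt {r : ℝ} (hr : 0 < r) :
    r * Real.exp (-realExponent r) < Real.exp (-1) := by
  have h1 : r ^ 2 + r ^ 3 ≤ realExponent r := by
    have e1 := Real.add_one_le_exp (r * Real.exp r)
    have e2 := Real.add_one_le_exp r
    have e3 : r * (r * (r + 1)) ≤ r * (Real.exp (r * Real.exp r) - 1) := by
      gcongr
      nlinarith
    rw [realExponent]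
    linarith
  have h2 : r ≤ 53 / 100 * Real.exp (100 / 53 * r - 1) := by
    linarith [Real.add_one_le_exp (100 / 53 * r - 1)]
  have h3 : 53 / 100 * Real.exp (3 / 5) < 1 := by
    have h4 : Real.exp (3 / 5) ^ 5 = Real.exp 1 ^ 3 := by
      rw [← Real.exp_nat_mul, ← Real.exp_nat_mul]; norm_num
    have h5 : Real.exp 1 ^ 3 < 2.7182818286 ^ 3 := by
      gcongr
      exact Real.exp_one_lt_d9
    by_contra! h6
    have h7 : (100 / 53 : ℝ) ^ 5 ≤ Real.exp (3 / 5) ^ 5 := by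
      gcongr
      linarith
    exact absurd ((h4 ▸ h7).trans_lt h5) (by norm_num)
  have h4 : 100 / 53 * r - 1 - realExponent r ≤ 3 / 5 + -1 := by
    nlinarith [mul_nonneg hr.le (sq_nonneg (r - 53 / 100)), sq_nonneg (r - 53 / 100)]
  calc r * Real.exp (-realExponent r)
      ≤ 53 / 100 * Real.exp (100 / 53 * r - 1) * Real.exp (-realExponent r) := by gcongr
    _ = 53 / 100 * Real.exp (100 / 53 * r - 1 - realExponent r) := by
        rw [mul_assoc, ← Real.exp_add, ← sub_eq_add_neg]
    _ ≤ 53 / 100 * Real.exp (3 / 5 + -1) := by gcongr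
    _ = 53 / 100 * Real.exp (3 / 5) * Real.exp (-1) := by rw [Real.exp_add, mul_assoc]
    _ < 1 * Real.exp (-1) := by gcongr
    _ = Real.exp (-1) := one_mul _

end Estimates

section Asymptotics

open Complex MeasureTheory

/-- The derivative of `z * (exp z + branchFun z)`. -/
noncomputable def weightFun (z : ℂ) : ℂ :=
  exp z + branchFun z + z * (exp z + (1 + z) * exp z * exp (z * exp z))

lemma differentiable_weightFun : Differentiable ℂ weightFun := by
  have := differentiable_branchFun
  unfold weightFun; fun_prop

variable {r : ℝ}

lemma tN_eq_circleIntegral (hr : 0 < r) (m : ℕ) :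
    ((m + 1 : ℕ) : ℂ) ^ 2 * (tN (m + 1) : ℂ) = (m + 1).factorial * ((2 * Real.pi * I)⁻¹ *
      ∮ z in C(0, r), weightFun z * (exp (z * branchFun z) / z) ^ (m + 1)) := by
  set N := m + 1 with hN
  have hb := differentiable_branchFun
  have hder : ∀ z ∈ Metric.sphere (0 : ℂ) r,
      HasDerivAt (fun z => z * (exp z + branchFun z) * (exp (z * branchFun z) / z) ^ N)
        (weightFun z * (exp (z * branchFun z) / z) ^ N - N * ((forestFun 1 0 N z +
          forestFun 0 1 N z) / z ^ N)) z := by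
    intro z hz
    have hz0 := ne_zero_of_mem_circle hr hz
    have h1 : HasDerivAt (fun z : ℂ => z * exp z) (1 * exp z + z * exp z) z :=
      (hasDerivAt_id z).mul (hasDerivAt_exp z)
    have h2 : HasDerivAt (fun z : ℂ => exp z + branchFun z) _ z :=
      (hasDerivAt_exp z).add (h1.cexp.sub_const 1)
    have h3 := ((hasDerivAt_id z).mul h2).mul (hasDerivAt_exp_mul_branchFun_div_pow N hz0)
    refine h3.congr_deriv ?_
    simp only [Pi.mul_apply, id, weightFun, forestFun, pow_zero, pow_one, one_mul, div_pow]
    field_simp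
    ring
  have h0 := circleIntegral.integral_eq_zero_of_hasDerivWithinAt hr.le fun z hz =>
    (hder z hz).hasDerivWithinAt
  have hci : CircleIntegrable (fun z => weightFun z * (exp (z * branchFun z) / z) ^ N) 0 r := by
    have := circleIntegrable_div_pow hr (g := fun z => weightFun z * exp (z * branchFun z) ^ N)
      (by have := differentiable_weightFun; fun_prop) N
    simpa only [div_pow, mul_div_assoc] using this
  have hf1 := circleIntegrable_div_pow hr (differentiable_forestFun 1 0 N) N
  have hf2 := circleIntegrable_div_pow hr (differentiable_forestFun 0 1 N) N
  have hsum : CircleIntegrable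
      (fun z => N * ((forestFun 1 0 N z + forestFun 0 1 N z) / z ^ N)) 0 r := by
    simp only [add_div]
    exact IntervalIntegrable.const_mul (hf1.add hf2) (N : ℂ)
  rw [circleIntegral.integral_sub hci hsum, circleIntegral.integral_const_mul,
    sub_eq_zero] at h0
  simp only [add_div] at h0
  rw [circleIntegral.integral_add hf1 hf2] at h0
  rw [h0, tN_eq_cauchyDeriv hr m, cauchyDeriv, cauchyDeriv, ← hN, hN, Nat.factorial_succ]
  push_cast
  ring

/-- The logarithm of the integrand on the circle of radius `r`, normalised at the saddle point. -/
noncomputable def phaseFun (r : ℝ) (w : ℂ) : ℂ :=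
  r * exp (w * I) * branchFun (r * exp (w * I)) - realExponent r - w * I

lemma differentiable_phaseFun : Differentiable ℂ (phaseFun r) := by
  have := differentiable_branchFun
  unfold phaseFun; fun_prop

lemma phaseFun_zero : phaseFun r 0 = 0 := by
  simp [phaseFun, ofReal_realExponent]

lemma deriv_phaseFun_zero (hr : (r : ℂ) * branchDeriv r = 1) : deriv (phaseFun r) 0 = 0 := by
  have h1 : HasDerivAt (fun w : ℂ => (r : ℂ) * exp (w * I)) (r * (exp (0 * I) * (1 * I))) 0 :=
    (((hasDerivAt_id (0 : ℂ)).mul_const I).cexp).const_mul _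
  have h2 : HasDerivAt (fun z => z * branchFun z) (branchDeriv r)
      ((fun w : ℂ => (r : ℂ) * exp (w * I)) 0) := by
    simpa using hasDerivAt_mul_branchFun (r : ℂ)
  have h3 := ((h2.comp (0 : ℂ) h1).sub_const (realExponent r : ℂ)).sub
    ((hasDerivAt_id (0 : ℂ)).mul_const I)
  have h4 : HasDerivAt (phaseFun r) _ 0 := h3
  rw [h4.deriv]
  simp only [zero_mul, exp_zero, one_mul]
  linear_combination I * hr

lemma re_phaseFun_le (hr0 : 0 < r) (hr1 : r ≤ 1) {θ : ℝ} (hθ : |θ| ≤ Real.pi) :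
    (phaseFun r θ).re ≤ -(3 * r ^ 3 / (2 * Real.pi ^ 2)) * θ ^ 2 := by
  have h := re_mul_branchFun_le hr0 hr1 hθ
  have h1 : ((θ : ℂ) * I).re = 0 := by simp
  rw [phaseFun, sub_re, sub_re, ofReal_re, h1]
  linarith

lemma tN_mul_pow_eq_integral (hr : 0 < r) {n : ℕ} (hn : n ≠ 0) :
    ((n : ℂ) ^ 2 * (tN n : ℂ)) * ((r * Real.exp (-realExponent r) : ℝ) : ℂ) ^ n / n.factorial =
      (2 * Real.pi : ℂ)⁻¹ * ∫ θ in (-Real.pi)..Real.pi,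
        (r * exp (θ * I) * weightFun (r * exp (θ * I))) * exp (n * phaseFun r θ) := by
  obtain ⟨m, rfl⟩ := Nat.exists_eq_succ_of_ne_zero hn
  rw [Nat.succ_eq_add_one, tN_eq_circleIntegral hr m]
  set N := m + 1
  set ρ : ℂ := ((r * Real.exp (-realExponent r) : ℝ) : ℂ) with hρ
  have hfac : (N.factorial : ℂ) ≠ 0 := by exact_mod_cast N.factorial_ne_zero
  have hrc : (r : ℂ) ≠ 0 := by exact_mod_cast hr.ne'
  have hcircle : (∮ z in C(0, r), weightFun z * (exp (z * branchFun z) / z) ^ N) * ρ ^ N =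
      I * ∫ θ in (-Real.pi)..Real.pi,
        (r * exp (θ * I) * weightFun (r * exp (θ * I))) * exp (N * phaseFun r θ) := by
    rw [mul_comm, ← circleIntegral.integral_const_mul, circleIntegral,
      ← intervalIntegral.integral_const_mul]
    have hfun : ∀ θ : ℝ, deriv (circleMap 0 r) θ • (ρ ^ N * (weightFun (circleMap 0 r θ) *
        (exp (circleMap 0 r θ * branchFun (circleMap 0 r θ)) / circleMap 0 r θ) ^ N)) =
        I * ((r * exp (θ * I) * weightFun (r * exp (θ * I))) * exp (N * phaseFun r θ)) := by
      intro θ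
      have h1 : exp (N * phaseFun r θ) = (ρ * (exp (r * exp (θ * I) *
          branchFun (r * exp (θ * I))) / (r * exp (θ * I)))) ^ N := by
        rw [exp_nat_mul, phaseFun, exp_sub, exp_sub, hρ]
        congr 1
        push_cast
        rw [exp_neg]
        field_simp
      rw [h1, deriv_circleMap, circleMap_zero, smul_eq_mul, mul_pow]
      ring
    simp only [hfun]
    have hper : Function.Periodic (fun θ : ℝ => I * ((r * exp (θ * I) *
        weightFun (r * exp (θ * I))) * exp (N * phaseFun r θ))) (2 * Real.pi) := by
      intro θ
      simp only [← hfun]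
      rw [deriv_circleMap, deriv_circleMap, periodic_circleMap 0 r θ]
    have := hper.intervalIntegral_add_eq 0 (-Real.pi)
    rw [zero_add, show -Real.pi + 2 * Real.pi = Real.pi by ring] at this
    exact this
  rw [mul_assoc, mul_assoc, hcircle]
  field_simp

end Asymptotics

theorem stmt_6 :
    ∃ c ρ₁ : ℝ, 0 < c ∧ 0 < ρ₁ ∧ ρ₁ < Real.exp (-1) ∧
      Tendsto
        (fun n : ℕ =>
          (tN n : ℝ) * ρ₁ ^ n * (n : ℝ) ^ ((5 : ℝ) / 2) / (Nat.factorial n : ℝ))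
        atTop (nhds c) := by
  obtain ⟨r, hr0, hr1, hr⟩ := exists_mul_branchDeriv_eq_one
  set ρ := r * Real.exp (-realExponent r) with hρ
  set κ := 3 * r ^ 3 / (2 * Real.pi ^ 2) with hκ
  have hκ0 : 0 < κ := by positivity
  set u : ℕ → ℝ := fun n =>
    (tN n : ℝ) * ρ ^ n * (n : ℝ) ^ ((5 : ℝ) / 2) / (Nat.factorial n : ℝ) with hu
  obtain ⟨g, hg⟩ := exists_tendsto_div_sq (differentiable_phaseFun (r := r)) phaseFun_zero
    (deriv_phaseFun_zero hr)
  have hg' : Tendsto (fun θ : ℝ => phaseFun r θ / (θ : ℂ) ^ 2) (𝓝[≠] 0) (𝓝 g) := by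
    refine hg.comp (tendsto_nhdsWithin_iff.2 ⟨?_, ?_⟩)
    · exact (Complex.continuous_ofReal.tendsto' 0 0 Complex.ofReal_zero).mono_left
        nhdsWithin_le_nhds
    · filter_upwards [self_mem_nhdsWithin] with θ hθ
      exact Complex.ofReal_ne_zero.2 hθ
  have hgre : g.re ≤ -κ := by
    refine le_of_tendsto ((Complex.continuous_re.tendsto g).comp hg') ?_
    have hmem : Set.Icc (-Real.pi) Real.pi ∈ 𝓝[≠] (0 : ℝ) := nhdsWithin_le_nhds
      (Icc_mem_nhds (by linarith [Real.pi_pos]) Real.pi_pos)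
    filter_upwards [self_mem_nhdsWithin, hmem] with θ hθ hθ'
    have hθ0 : 0 < θ ^ 2 := by have : θ ≠ 0 := hθ; positivity
    have h := re_phaseFun_le hr0 hr1 (abs_le.2 hθ')
    simp only [Function.comp]
    rw [← Complex.ofReal_pow, Complex.div_ofReal_re, div_le_iff₀ hθ0]
    exact h
  set P : ℝ → ℂ := fun θ => r * Complex.exp (θ * Complex.I) *
    weightFun (r * Complex.exp (θ * Complex.I)) with hP
  have hPc : Continuous P := by
    have := differentiable_weightFun.continuous
    fun_prop
  have hfc : Continuous fun θ : ℝ => phaseFun r θ :=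
    differentiable_phaseFun.continuous.comp Complex.continuous_ofReal
  set L : ℂ := (2 * Real.pi : ℂ)⁻¹ * (P 0 * ∫ t : ℝ, Complex.exp (g * (t : ℂ) ^ 2)) with hL
  have hlim : Tendsto (fun n => (u n : ℂ)) atTop (𝓝 L) := by
    have h := (tendsto_sqrt_mul_integral_exp hκ0 hPc hfc
      (fun θ hθ => re_phaseFun_le hr0 hr1 hθ) hg').const_mul (2 * Real.pi : ℂ)⁻¹
    refine h.congr' ?_
    filter_upwards [eventually_gt_atTop 0] with n hn
    have h1 := tN_mul_pow_eq_integral hr0 hn.ne'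
    have h2 : (n : ℝ) ^ ((5 : ℝ) / 2) = n ^ 2 * Real.sqrt n := by
      rw [Real.sqrt_eq_rpow, ← Real.rpow_natCast, ← Real.rpow_add (by exact_mod_cast hn)]
      norm_num
    rw [mul_left_comm, ← h1, ← hρ, hu]
    simp only [h2]
    push_cast
    ring
  have hL0 : L ≠ 0 := by
    have hb : 0 < (-g).re := by rw [Complex.neg_re]; linarith
    have hb0 : -g ≠ 0 := fun h => by simp [h] at hb
    have hgauss := integral_gaussian_complex hb
    rw [neg_neg] at hgauss
    rw [hL, hgauss]
    have hpi : (Real.pi : ℂ) ≠ 0 := Complex.ofReal_ne_zero.2 Real.pi_ne_zero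
    refine mul_ne_zero (inv_ne_zero (mul_ne_zero two_ne_zero hpi)) (mul_ne_zero ?_ ?_)
    · have hW : P 0 = ((r * (Real.exp r + (Real.exp (r * Real.exp r) - 1) +
          r * (Real.exp r + (1 + r) * Real.exp r * Real.exp (r * Real.exp r))) : ℝ) : ℂ) := by
        simp [hP, weightFun, branchFun]
      rw [hW, Complex.ofReal_ne_zero]
      have : 0 ≤ Real.exp (r * Real.exp r) - 1 := by
        linarith [Real.one_le_exp (by positivity : 0 ≤ r * Real.exp r)]
      positivity
    · rw [Complex.cpow_ne_zero_iff]
      exact Or.inl (div_ne_zero hpi hb0)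
  have hre : Tendsto u atTop (𝓝 L.re) := (Complex.continuous_re.tendsto L).comp hlim
  have him : L.im = 0 := by
    refine tendsto_nhds_unique ((Complex.continuous_im.tendsto L).comp hlim) ?_
    simp [Function.comp_def]
  refine ⟨L.re, ρ, ?_, by positivity, mul_exp_neg_realExponent_lt hr0, hre⟩
  refine (ge_of_tendsto' hre fun n => ?_).lt_of_ne fun h => hL0 (Complex.ext h.symm him)
  simp only [hu]
  positivity
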